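/- arXiv:1610.05890 — 2 statements merged into one kernel-verified Lean document; each statement's English description precedes it below -/
import Mathlib

section
/- Consider the uncertain discrete-time network model under assumptions (H1), (H2), (H3). Then for every family of constants r_i > 0 (i = 1,…,n) satisfying r_i > Σ_{j=1}^n r_j p_{i,j} for every i, and for every family of constants ε̃_i ∈ (0, min(v_i^max, min{g_i(d,0) : d ∈ D})) (i = 1,…,n), there exists a constant C > 0 such that Σ_{i=1}^n r_i x_i⁺ ≤ (1−C) Σ_{i=1}^n r_i x_i + Σ_{i=1}^n r_i v_i for all (d,x) ∈ D × S and all v ∈ ℝ₊ⁿ with v_i ≤ min(v_i^max, min{g_i(d,0) : d ∈ D}) − ε̃_i for i = 1,…,n, where x⁺ denotes the state update of the network model. -/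
open Matrix

/-- The state set `S = [0,a₁] × ⋯ × [0,aₙ]`. -/
def stateSet {n : ℕ} (a : Fin n → ℝ) : Set (Fin n → ℝ) :=
  {x | ∀ i, x i ∈ Set.Icc 0 (a i)}

/-- The Euclidean norm of `x ∈ ℝⁿ`. -/
noncomputable def euclNorm {n : ℕ} (x : Fin n → ℝ) : ℝ :=
  Real.sqrt (∑ i, x i ^ 2)

/-- The map `h(x) = (max(0,x₁),…,max(0,xₙ))'`. -/
def posVec {n : ℕ} (x : Fin n → ℝ) : Fin n → ℝ :=
  fun i => max 0 (x i)

/-- The general uncertain, discrete-time network model (2.9): `n` cells with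
capacities `a i`, a non-empty compact disturbance set `D ⊆ ℝˡ`, demand functions
`f`, congestion functions `s`, inflow functions `w`, turning rates `p`, exit
rates `Q` and supply functions `g`, satisfying the standing modelling
assumptions, including (2.7) and (2.8). -/
structure Network (n l : ℕ) where
  /-- storage capacities -/
  a : Fin n → ℝ
  ha : ∀ i, 0 < a i
  /-- the disturbance set -/
  D : Set (Fin l → ℝ)
  hD : D.Nonempty
  hD_compact : IsCompact D
  /-- demand functions `f i : D × [0, a i] → ℝ₊` -/
  f : Fin n → (Fin l → ℝ) → ℝ → ℝ
  /-- congestion functions `s i : D × S × ℝ₊ⁿ → [0,1]` -/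
  s : Fin n → (Fin l → ℝ) → (Fin n → ℝ) → (Fin n → ℝ) → ℝ
  /-- inflow functions `w i : D × S × ℝ₊ⁿ → [0,1]` -/
  w : Fin n → (Fin l → ℝ) → (Fin n → ℝ) → (Fin n → ℝ) → ℝ
  /-- turning rates -/
  p : Fin n → Fin n → ℝ
  /-- exit rates -/
  Q : Fin n → ℝ
  /-- supply functions `g i : D × S → ℝ₊` -/
  g : Fin n → (Fin l → ℝ) → (Fin n → ℝ) → ℝ
  hf_nonneg : ∀ i, ∀ d ∈ D, ∀ z ∈ Set.Icc (0 : ℝ) (a i), 0 ≤ f i d z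
  hf_le : ∀ i, ∀ d ∈ D, ∀ z ∈ Set.Icc (0 : ℝ) (a i), f i d z ≤ z
  hs01 : ∀ i, ∀ d ∈ D, ∀ x ∈ stateSet a, ∀ v : Fin n → ℝ, (∀ j, 0 ≤ v j) →
    s i d x v ∈ Set.Icc (0 : ℝ) 1
  hw01 : ∀ i, ∀ d ∈ D, ∀ x ∈ stateSet a, ∀ v : Fin n → ℝ, (∀ j, 0 ≤ v j) →
    w i d x v ∈ Set.Icc (0 : ℝ) 1
  hp_nonneg : ∀ i j, 0 ≤ p i j
  hp_diag : ∀ i, p i i = 0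
  hQ_nonneg : ∀ i, 0 ≤ Q i
  /-- (2.5): `∑ j, p i j + Q i = 1` -/
  hpQ : ∀ i, (∑ j, p i j) + Q i = 1
  hg_cont : ∀ i, ContinuousOn (fun q : (Fin l → ℝ) × (Fin n → ℝ) => g i q.1 q.2)
    (D ×ˢ stateSet a)
  hg_nonneg : ∀ i, ∀ d ∈ D, ∀ x ∈ stateSet a, 0 ≤ g i d x
  hg_pos : ∀ i, ∀ d ∈ D, ∀ x ∈ stateSet a, x i < a i →
    0 < g i d x ∧ g i d x ≤ a i - x i
  /-- (2.7): the total inflow of each cell is bounded by its supply -/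
  h27 : ∀ i, ∀ d ∈ D, ∀ x ∈ stateSet a, ∀ v : Fin n → ℝ, (∀ j, 0 ≤ v j) →
    w i d x v * v i + ∑ j, p j i * (s j d x v * f j d (x j)) ≤ g i d x
  /-- (2.8): if every attempted total inflow can be accommodated, no congestion -/
  h28 : ∀ d ∈ D, ∀ x ∈ stateSet a, ∀ v : Fin n → ℝ, (∀ j, 0 ≤ v j) →
    (∀ i, v i + ∑ j, p j i * f j d (x j) ≤ g i d x) →
    ∀ i, w i d x v = 1 ∧ s i d x v = 1

/-- The state update map (2.9):
`x i ⁺ = x i + w i v i − s i f i (x i) + ∑ j, p j i * s j * f j (x j)`. -/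
def Network.update {n l : ℕ} (N : Network n l) (d : Fin l → ℝ)
    (x v : Fin n → ℝ) : Fin n → ℝ :=
  fun i => x i + N.w i d x v * v i - N.s i d x v * N.f i d (x i)
    + ∑ j, N.p j i * (N.s j d x v * N.f j d (x j))

/-- Assumption (H1) on the demand functions. -/
structure H1 {n l : ℕ} (N : Network n l) where
  /-- critical densities -/
  δ : Fin n → ℝ
  δt : Fin n → ℝ
  L : Fin n → ℝ
  G : Fin n → ℝ
  fmin : Fin n → ℝ
  hδ : ∀ i, δ i ∈ Set.Ioc 0 (N.a i)
  hδt : ∀ i, δt i ∈ Set.Ioc 0 (δ i)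
  hL : ∀ i, L i ∈ Set.Ioo (0 : ℝ) 1
  hG : ∀ i, G i ∈ Set.Ioc (0 : ℝ) 1
  hf_pos : ∀ i, ∀ d ∈ N.D, ∀ z ∈ Set.Ioc (0 : ℝ) (N.a i),
    0 < N.f i d z ∧ N.f i d z < z
  hf_cont : ∀ i, ∀ d ∈ N.D, ContinuousOn (N.f i d) (Set.Icc 0 (δ i))
  hf_mono : ∀ i, ∀ d ∈ N.D, StrictMonoOn (N.f i d) (Set.Icc 0 (δ i))
  hlip_low : ∀ i, ∀ d ∈ N.D, ∀ y ∈ Set.Icc (0 : ℝ) (δt i), ∀ z ∈ Set.Icc (0 : ℝ) (δt i),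
    L i * |z - y| ≤ |N.f i d z - N.f i d y|
  hlip_up : ∀ i, ∀ d ∈ N.D, ∀ y ∈ Set.Icc (0 : ℝ) (δ i), ∀ z ∈ Set.Icc (0 : ℝ) (δ i),
    |N.f i d z - N.f i d y| ≤ G i * |z - y|
  hfmin_pos : ∀ i, 0 < fmin i
  hfmin : ∀ i, ∀ d ∈ N.D, ∀ z ∈ Set.Icc (δ i) (N.a i), fmin i ≤ N.f i d z

/-- Assumption (H2): the turning-rate matrix is strictly upper triangular. -/
def Network.H2 {n l : ℕ} (N : Network n l) : Prop :=
  ∀ i j : Fin n, (j : ℕ) ≤ (i : ℕ) → N.p i j = 0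

/-- Assumption (H3): continuous positive-definite lower bounds `s̃ i` for the
congestion functions, and constants `vmax i > 0`, such that
`x i * s̃ i (d,x,v) = 0` for all `i` together with `v i < vmax i` for all `i`
imply `x = 0`. -/
structure H3 {n l : ℕ} (N : Network n l) where
  st : Fin n → (Fin l → ℝ) → (Fin n → ℝ) → (Fin n → ℝ) → ℝ
  vmax : Fin n → ℝ
  hvmax : ∀ i, 0 < vmax i
  hst_cont : ∀ i, ContinuousOn
    (fun q : (Fin l → ℝ) × (Fin n → ℝ) × (Fin n → ℝ) => st i q.1 q.2.1 q.2.2)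
    (N.D ×ˢ stateSet N.a ×ˢ {v | ∀ j, 0 ≤ v j})
  hst01 : ∀ i, ∀ d ∈ N.D, ∀ x ∈ stateSet N.a, ∀ v : Fin n → ℝ, (∀ j, 0 ≤ v j) →
    st i d x v ∈ Set.Icc (0 : ℝ) 1
  hst_le : ∀ i, ∀ d ∈ N.D, ∀ x ∈ stateSet N.a, ∀ v : Fin n → ℝ, (∀ j, 0 ≤ v j) →
    st i d x v ≤ N.s i d x v
  himp : ∀ d ∈ N.D, ∀ x ∈ stateSet N.a, ∀ v : Fin n → ℝ, (∀ j, 0 ≤ v j) →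
    (∀ i, x i * st i d x v = 0) → (∀ i, v i < vmax i) → x = 0

/-- Assumption (H4): there exist `μ i ∈ (0, δt i)` such that whenever `x ≤ μ`,
`vmax i + ∑ j, p j i * f j (x j) ≤ g i (d, x)` for every `i`. -/
structure H4 {n l : ℕ} (N : Network n l) (δt vmax : Fin n → ℝ) where
  μ : Fin n → ℝ
  hμ : ∀ i, μ i ∈ Set.Ioo (0 : ℝ) (δt i)
  hsupply : ∀ i, ∀ d ∈ N.D, ∀ x ∈ stateSet N.a, (∀ j, x j ≤ μ j) →
    vmax i + ∑ j, N.p j i * N.f j d (x j) ≤ N.g i d x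

/-- `min { g i (d, 0) : d ∈ D }` (as an infimum). -/
noncomputable def Network.gmin {n l : ℕ} (N : Network n l) (i : Fin n) : ℝ :=
  sInf ((fun d => N.g i d 0) '' N.D)

/-- The feedback law (3.3):
`v = v* − diag(v* − b) (1ₙ − h(1ₙ − τ⁻¹ K h(x − x*)))`. -/
noncomputable def feedback {n : ℕ} (vstar b : Fin n → ℝ)
    (K : Matrix (Fin n) (Fin n) ℝ) (τ : ℝ) (xstar x : Fin n → ℝ) : Fin n → ℝ :=
  fun i => vstar i - (vstar i - b i) *
    (1 - max 0 (1 - τ⁻¹ * ∑ j, K i j * max 0 (x j - xstar j)))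

/-- `x : ℕ → ℝⁿ` is a solution of the closed-loop system (2.9) with (3.3) for the
disturbance sequence `d`. -/
def IsClosedLoopSolution {n l : ℕ} (N : Network n l) (vstar b : Fin n → ℝ)
    (K : Matrix (Fin n) (Fin n) ℝ) (τ : ℝ) (xstar : Fin n → ℝ)
    (d : ℕ → Fin l → ℝ) (x : ℕ → Fin n → ℝ) : Prop :=
  ∀ t, x (t + 1) = N.update (d t) (x t) (feedback vstar b K τ xstar (x t))

theorem H1.exists_linear_le_demand {n l : ℕ} {N : Network n l} (h1 : H1 N) (i : Fin n) :
    ∃ k > (0 : ℝ), ∀ d ∈ N.D, ∀ z ∈ Set.Icc 0 (N.a i), k * z ≤ N.f i d z := by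
  have ha := N.ha i
  obtain ⟨hδ, hδa⟩ := h1.hδ i
  obtain ⟨hδt, hδtδ⟩ := h1.hδt i
  obtain ⟨hL, -⟩ := h1.hL i
  have hm := h1.hfmin_pos i
  have hlow : ∀ d ∈ N.D, ∀ z ∈ Set.Icc 0 (h1.δt i), h1.L i * z ≤ N.f i d z := by
    intro d hd z hz
    have h0 : N.f i d 0 = 0 :=
      le_antisymm (N.hf_le i d hd 0 ⟨le_rfl, ha.le⟩) (N.hf_nonneg i d hd 0 ⟨le_rfl, ha.le⟩)
    have h := h1.hlip_low i d hd 0 ⟨le_rfl, hδt.le⟩ z hz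
    rwa [h0, sub_zero, sub_zero, abs_of_nonneg hz.1,
      abs_of_nonneg (N.hf_nonneg i d hd z ⟨hz.1, hz.2.trans (hδtδ.trans hδa)⟩)] at h
  have hscale : ∀ c z : ℝ, 0 ≤ c → z ≤ N.a i → c / N.a i * z ≤ c := by
    intro c z hc hz
    rw [div_mul_eq_mul_div, div_le_iff₀ ha]
    exact mul_le_mul_of_nonneg_left hz hc
  refine ⟨min (h1.L i) (min (h1.L i * h1.δt i / N.a i) (h1.fmin i / N.a i)),
    by positivity, fun d hd z hz => ?_⟩
  rcases le_total z (h1.δt i) with hzt | hzt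
  · exact (mul_le_mul_of_nonneg_right (min_le_left _ _) hz.1).trans (hlow d hd z ⟨hz.1, hzt⟩)
  rcases le_total z (h1.δ i) with hzδ | hzδ
  · calc _ ≤ h1.L i * h1.δt i / N.a i * z :=
          mul_le_mul_of_nonneg_right ((min_le_right _ _).trans (min_le_left _ _)) hz.1
      _ ≤ h1.L i * h1.δt i := hscale _ z (by positivity) hz.2
      _ ≤ N.f i d (h1.δt i) := hlow d hd _ ⟨hδt.le, le_rfl⟩
      _ ≤ N.f i d z := (h1.hf_mono i d hd).monotoneOn ⟨hδt.le, hδtδ⟩ ⟨hz.1, hzδ⟩ hzt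
  · calc _ ≤ h1.fmin i / N.a i * z :=
          mul_le_mul_of_nonneg_right ((min_le_right _ _).trans (min_le_right _ _)) hz.1
      _ ≤ h1.fmin i := hscale _ z hm.le hz.2
      _ ≤ N.f i d z := h1.hfmin i d hd z ⟨hzδ, hz.2⟩

theorem zero_mem_stateSet {n l : ℕ} (N : Network n l) : (0 : Fin n → ℝ) ∈ stateSet N.a :=
  fun i => ⟨le_rfl, (N.ha i).le⟩

theorem isCompact_stateSet {n : ℕ} (a : Fin n → ℝ) : IsCompact (stateSet a) := by
  have h : stateSet a = Set.pi Set.univ fun i => Set.Icc 0 (a i) := by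
    ext x
    simp only [stateSet, Set.mem_pi, Set.mem_univ, true_imp_iff, Set.mem_ofPred_eq]
  rw [h]
  exact isCompact_univ_pi fun i => isCompact_Icc

theorem Network.gmin_le {n l : ℕ} (N : Network n l) (i : Fin n) {d : Fin l → ℝ}
    (hd : d ∈ N.D) : N.gmin i ≤ N.g i d 0 := by
  refine csInf_le ⟨0, ?_⟩ (Set.mem_image_of_mem _ hd)
  rintro _ ⟨e, he, rfl⟩
  exact N.hg_nonneg i e he 0 (zero_mem_stateSet N)

/-- States and inflows for which the supply of cell `i` could be exhausted. -/
def Network.congestedSet {n l : ℕ} (N : Network n l) (b : Fin n → ℝ) (i : Fin n) :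
    Set ((Fin l → ℝ) × (Fin n → ℝ) × (Fin n → ℝ)) :=
  (N.D ×ˢ stateSet N.a ×ˢ stateSet b) ∩
    (fun q => N.g i q.1 q.2.1 - (q.2.2 i + ∑ j, N.p j i * q.2.1 j)) ⁻¹' Set.Iic 0

theorem Network.isCompact_congestedSet {n l : ℕ} (N : Network n l) (b : Fin n → ℝ) (i : Fin n) :
    IsCompact (N.congestedSet b i) := by
  have hK : IsCompact (N.D ×ˢ stateSet N.a ×ˢ stateSet b) :=
    N.hD_compact.prod ((isCompact_stateSet N.a).prod (isCompact_stateSet b))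
  refine hK.of_isClosed_subset ?_ Set.inter_subset_left
  refine ContinuousOn.preimage_isClosed_of_isClosed ?_ hK.isClosed isClosed_Iic
  refine ContinuousOn.sub ?_ (Continuous.continuousOn (by fun_prop))
  exact (N.hg_cont i).comp (f := fun q : (Fin l → ℝ) × (Fin n → ℝ) × (Fin n → ℝ) => (q.1, q.2.1))
    (Continuous.continuousOn (by fun_prop)) fun q hq => ⟨hq.1, hq.2.1⟩

theorem H3.exists_pos_le_sum_on_congestedSet {n l : ℕ} {N : Network n l} (h3 : H3 N)
    {r b : Fin n → ℝ} (hr : ∀ i, 0 < r i) (hb : ∀ i, b i < min (h3.vmax i) (N.gmin i)) :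
    ∃ m > (0 : ℝ), ∀ d x v, (d, x, v) ∈ ⋃ i, N.congestedSet b i →
      m ≤ ∑ i, r i * (x i * h3.st i d x v) := by
  have hcont : ContinuousOn (fun q : (Fin l → ℝ) × (Fin n → ℝ) × (Fin n → ℝ) =>
      ∑ i, r i * (q.2.1 i * h3.st i q.1 q.2.1 q.2.2)) (⋃ i, N.congestedSet b i) := by
    refine continuousOn_finsetSum _ fun i _ => continuousOn_const.mul
      (ContinuousOn.mul (Continuous.continuousOn (by fun_prop)) ((h3.hst_cont i).mono ?_))
    refine Set.iUnion_subset fun k q hq => ?_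
    exact ⟨hq.1.1, hq.1.2.1, fun j => (hq.1.2.2 j).1⟩
  suffices hpos : ∀ q ∈ ⋃ i, N.congestedSet b i,
      0 < ∑ i, r i * (q.2.1 i * h3.st i q.1 q.2.1 q.2.2) by
    obtain ⟨m, hm, h⟩ :=
      (isCompact_iUnion fun i => N.isCompact_congestedSet b i).exists_forall_le' hcont hpos
    exact ⟨m, hm, fun d x v hq => h (d, x, v) hq⟩
  rintro ⟨d, x, v⟩ hq
  obtain ⟨k, ⟨hd, hx, hv⟩, hk⟩ := Set.mem_iUnion.1 hq
  simp only at hd hx hv ⊢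
  have hv0 : ∀ j, 0 ≤ v j := fun j => (hv j).1
  have hterm : ∀ i, 0 ≤ r i * (x i * h3.st i d x v) := fun i =>
    mul_nonneg (hr i).le (mul_nonneg (hx i).1 (h3.hst01 i d hd x hx v hv0).1)
  refine (Finset.sum_nonneg fun i _ => hterm i).lt_of_ne' fun h0 => ?_
  have hzero := (Finset.sum_eq_zero_iff_of_nonneg fun i _ => hterm i).1 h0
  have hx0 : x = 0 := h3.himp d hd x hx v hv0
    (fun i => (mul_eq_zero.1 (hzero i (Finset.mem_univ i))).resolve_left (hr i).ne')
    fun i => ((hv i).2.trans_lt (hb i)).trans_le (min_le_left _ _)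
  subst hx0
  have hkg : N.g k d 0 ≤ v k := by simpa using hk
  have := ((hv k).2.trans_lt (hb k)).trans_le ((min_le_right _ _).trans (N.gmin_le k hd))
  linarith

theorem H3.exists_linear_le_weighted_sum {n l : ℕ} {N : Network n l} (h3 : H3 N)
    {r b : Fin n → ℝ} (hr : ∀ i, 0 < r i) (hb : ∀ i, b i < min (h3.vmax i) (N.gmin i)) :
    ∃ κ > (0 : ℝ), ∀ d ∈ N.D, ∀ x ∈ stateSet N.a, ∀ v ∈ stateSet b,
      κ * ∑ i, r i * x i ≤ ∑ i, r i * (x i * N.s i d x v) := by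
  obtain ⟨m, hm, h⟩ := h3.exists_pos_le_sum_on_congestedSet hr hb
  have hA : 0 ≤ ∑ i, r i * N.a i :=
    Finset.sum_nonneg fun i _ => mul_nonneg (hr i).le (N.ha i).le
  refine ⟨min 1 (m / (1 + ∑ i, r i * N.a i)), by positivity, fun d hd x hx v hv => ?_⟩
  have hv0 : ∀ j, 0 ≤ v j := fun j => (hv j).1
  have hX : 0 ≤ ∑ i, r i * x i := Finset.sum_nonneg fun i _ => mul_nonneg (hr i).le (hx i).1
  by_cases hq : (d, x, v) ∈ ⋃ i, N.congestedSet b i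
  · have hXA : ∑ i, r i * x i ≤ 1 + ∑ i, r i * N.a i :=
      (Finset.sum_le_sum fun i _ => mul_le_mul_of_nonneg_left (hx i).2 (hr i).le).trans
        (by linarith)
    calc _ ≤ m / (1 + ∑ i, r i * N.a i) * ∑ i, r i * x i :=
          mul_le_mul_of_nonneg_right (min_le_right _ _) hX
      _ ≤ m := by
          rw [div_mul_eq_mul_div, div_le_iff₀ (by linarith)]
          exact mul_le_mul_of_nonneg_left hXA hm.le
      _ ≤ _ := h d x v hq
      _ ≤ _ := Finset.sum_le_sum fun i _ => mul_le_mul_of_nonneg_left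
          (mul_le_mul_of_nonneg_left (h3.hst_le i d hd x hx v hv0) (hx i).1) (hr i).le
  · have hs : ∀ i, N.s i d x v = 1 := fun i => by
      refine (N.h28 d hd x hx v hv0 (fun k => ?_) i).2
      have hk : ¬ N.g k d x - (v k + ∑ j, N.p j k * x j) ≤ 0 := fun hk =>
        hq (Set.mem_iUnion.2 ⟨k, ⟨hd, hx, hv⟩, hk⟩)
      have hsum : ∑ j, N.p j k * N.f j d (x j) ≤ ∑ j, N.p j k * x j :=
        Finset.sum_le_sum fun j _ =>
          mul_le_mul_of_nonneg_left (N.hf_le j d hd _ (hx j)) (N.hp_nonneg j k)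
      linarith
    simp only [hs, mul_one]
    exact mul_le_of_le_one_left hX (min_le_left _ _)

theorem Network.sum_mul_update {n l : ℕ} (N : Network n l) (r : Fin n → ℝ) (d : Fin l → ℝ)
    (x v : Fin n → ℝ) :
    ∑ i, r i * N.update d x v i = ∑ i, r i * x i + ∑ i, r i * (N.w i d x v * v i)
      - ∑ i, (r i - ∑ j, r j * N.p i j) * (N.s i d x v * N.f i d (x i)) := by
  have hswap : ∑ i, r i * ∑ j, N.p j i * (N.s j d x v * N.f j d (x j)) =
      ∑ i, (∑ j, r j * N.p i j) * (N.s i d x v * N.f i d (x i)) := by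
    simp only [Finset.mul_sum, Finset.sum_mul]
    rw [Finset.sum_comm]
    simp only [mul_assoc]
  simp only [Network.update, mul_add, mul_sub, sub_mul, Finset.sum_add_distrib,
    Finset.sum_sub_distrib, hswap]
  ring

/-- **Proposition 2.4.** Under (H1), (H2), (H3), for every family of constants
`r i > 0` with `r i > ∑ j, r j * p i j` and every family of constants
`εt i ∈ (0, min(vmax i, min{g i (d,0) : d ∈ D}))`, there exists `C > 0` such that
`∑ i, r i * x i ⁺ ≤ (1 − C) ∑ i, r i * x i + ∑ i, r i * v i` for all
`(d, x) ∈ D × S` and all `v ∈ ℝ₊ⁿ` with `v i ≤ min(vmax i, min{g i (d,0) : d ∈ D}) − εt i`. -/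
theorem stmt5 {n l : ℕ} (hn : 1 ≤ n) (N : Network n l)
    (h1 : H1 N) (h2 : N.H2) (h3 : H3 N)
    (r : Fin n → ℝ) (hr : ∀ i, 0 < r i)
    (hr' : ∀ i, ∑ j, r j * N.p i j < r i)
    (εt : Fin n → ℝ)
    (hεt : ∀ i, εt i ∈ Set.Ioo 0 (min (h3.vmax i) (N.gmin i))) :
    ∃ C > (0 : ℝ), ∀ d ∈ N.D, ∀ x ∈ stateSet N.a, ∀ v : Fin n → ℝ,
      (∀ i, 0 ≤ v i ∧ v i ≤ min (h3.vmax i) (N.gmin i) - εt i) →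
      ∑ i, r i * N.update d x v i ≤
        (1 - C) * ∑ i, r i * x i + ∑ i, r i * v i := by
  have : Nonempty (Fin n) := ⟨⟨0, hn⟩⟩
  choose k hk hkf using h1.exists_linear_le_demand
  obtain ⟨κ, hκ, hκs⟩ := h3.exists_linear_le_weighted_sum (r := r)
    (b := fun i => min (h3.vmax i) (N.gmin i) - εt i) hr fun i => sub_lt_self _ (hεt i).1
  have hc : ∀ i, 0 < r i - ∑ j, r j * N.p i j := fun i => sub_pos.2 (hr' i)
  obtain ⟨i₀, hi₀⟩ := Finite.exists_min fun i => (r i - ∑ j, r j * N.p i j) * k i / r i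
  set θ := (r i₀ - ∑ j, r j * N.p i₀ j) * k i₀ / r i₀
  have hθ : 0 < θ := div_pos (mul_pos (hc i₀) (hk i₀)) (hr i₀)
  refine ⟨θ * κ, mul_pos hθ hκ, fun d hd x hx v hv => ?_⟩
  have hv0 : ∀ j, 0 ≤ v j := fun j => (hv j).1
  have hin : ∑ i, r i * (N.w i d x v * v i) ≤ ∑ i, r i * v i :=
    Finset.sum_le_sum fun i _ => mul_le_mul_of_nonneg_left
      (mul_le_of_le_one_left (hv0 i) (N.hw01 i d hd x hx v hv0).2) (hr i).le
  have hout : θ * (κ * ∑ i, r i * x i) ≤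
      ∑ i, (r i - ∑ j, r j * N.p i j) * (N.s i d x v * N.f i d (x i)) := by
    refine (mul_le_mul_of_nonneg_left (hκs d hd x hx v hv) hθ.le).trans ?_
    rw [Finset.mul_sum]
    refine Finset.sum_le_sum fun i _ => ?_
    have hs := (N.hs01 i d hd x hx v hv0).1
    calc θ * (r i * (x i * N.s i d x v)) = θ * r i * (x i * N.s i d x v) := by ring
      _ ≤ (r i - ∑ j, r j * N.p i j) * k i * (x i * N.s i d x v) :=
          mul_le_mul_of_nonneg_right ((le_div_iff₀ (hr i)).1 (hi₀ i))
            (mul_nonneg (hx i).1 hs)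
      _ = (r i - ∑ j, r j * N.p i j) * (N.s i d x v * (k i * x i)) := by ring
      _ ≤ _ := mul_le_mul_of_nonneg_left
          (mul_le_mul_of_nonneg_left (hkf i d hd _ (hx i)) hs) (hc i).le
  rw [N.sum_mul_update]
  linarith
end

section
/- Consider the uncertain discrete-time network model under assumptions (H1), (H2), (H3), (H4). Assume the existence of a point x* ∈ S with x_i* ∈ (0,μ_i) for all i and a vector v* ∈ ℝ₊ⁿ with v_i* < min(v_i^max, min{g_i(d,0) : d ∈ D}) for all i, satisfying f_i(d,x_i*) = v_i* + Σ_{j=1}^n p_{j,i} f_j(d,x_j*) for all i and all d ∈ D. Let r ∈ ℝⁿ with r_i > 0 satisfy r_i > Σ_{j=1}^n r_j p_{i,j} for every i, and let C > 0 be a constant such that Σ_{i=1}^n r_i x_i⁺ ≤ (1−C) Σ_{i=1}^n r_i x_i + Σ_{i=1}^n r_i v_i holds for all (d,x) ∈ D × S and all v ∈ ℝ₊ⁿ with v_i ≤ v_i* for all i. Assume there exists b ∈ ℝ₊ⁿ with b ≤ v* such that r'b ≤ C min_{i=1,…,n}(r_i x_i*). Then there exist constants β_i ∈ (x_i*, μ_i]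 (i = 1,…,n) and a non-negative matrix K ∈ ℝ₊^{n×n} such that for every τ ∈ (0,1) the set Ω = [0,β_1] × … × [0,β_n] is a trapping region for the closed-loop system obtained from the network update with the inflow v given by the feedback law (3.3). -/
open Matrix

theorem exists_pos_forall_le {ι : Type*} [Finite ι] (c : ι → ℝ) (hc : ∀ i, 0 < c i) :
    ∃ ε : ℝ, 0 < ε ∧ ∀ i, ε ≤ c i := by
  have h : ∀ᶠ ε in nhdsWithin (0 : ℝ) (Set.Ioi 0), ∀ i, ε ≤ c i :=
    Filter.eventually_all.2 fun i =>
      nhdsWithin_le_nhds (Iic_mem_nhds (hc i))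
  obtain ⟨ε, hle, hε⟩ := (h.and eventually_mem_nhdsWithin).exists
  exact ⟨ε, hε, hle⟩

/-- A strictly upper triangular substochastic matrix admits arbitrarily small positive vectors
that are subinvariant with respect to given positive weights. -/
theorem exists_pos_subinvariant {n : ℕ} (p : Fin n → Fin n → ℝ)
    (hp : ∀ i j, p i j ≤ 1) (htri : ∀ i j : Fin n, (j : ℕ) ≤ (i : ℕ) → p i j = 0)
    (L κ : Fin n → ℝ) (hL : ∀ i, 0 < L i) (hκ : ∀ i, 0 < κ i) :
    ∃ e : Fin n → ℝ, (∀ i, 0 < e i ∧ e i ≤ κ i) ∧ ∀ i, ∑ j, p j i * e j ≤ L i * e i := by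
  obtain ⟨q, hq, hqL⟩ := exists_pos_forall_le L hL
  set M : ℝ := n / q + 1 with hM
  have hM1 : 1 ≤ M := by
    have : 0 ≤ (n : ℝ) / q := by positivity
    linarith
  have hM0 : 0 < M := by linarith
  have hqM : (n : ℝ) / M ≤ q := by
    rw [div_le_iff₀ hM0, hM, mul_add, mul_div_cancel₀ _ hq.ne']
    linarith
  obtain ⟨ε, hε, hεκ⟩ := exists_pos_forall_le (fun i : Fin n => κ i / M ^ (i : ℕ))
    fun i => div_pos (hκ i) (pow_pos hM0 _)
  refine ⟨fun i => ε * M ^ (i : ℕ),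
    fun i => ⟨by positivity, (le_div_iff₀ (by positivity)).1 (hεκ i)⟩, fun i => ?_⟩
  have hterm : ∀ j ∈ Finset.univ, p j i * (ε * M ^ (j : ℕ)) ≤ ε * M ^ (i : ℕ) / M := by
    intro j _
    by_cases hij : (i : ℕ) ≤ (j : ℕ)
    · rw [htri j i hij, zero_mul]
      positivity
    · rw [le_div_iff₀ hM0]
      have hpow : M ^ ((j : ℕ) + 1) ≤ M ^ (i : ℕ) := pow_le_pow_right₀ hM1 (by omega)
      calc p j i * (ε * M ^ (j : ℕ)) * M = p j i * (ε * M ^ ((j : ℕ) + 1)) := by ring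
        _ ≤ 1 * (ε * M ^ ((j : ℕ) + 1)) :=
          mul_le_mul_of_nonneg_right (hp j i) (by positivity)
        _ ≤ ε * M ^ (i : ℕ) := by
          rw [one_mul]
          exact mul_le_mul_of_nonneg_left hpow hε.le
  calc ∑ j, p j i * (ε * M ^ (j : ℕ)) ≤ ∑ _j : Fin n, ε * M ^ (i : ℕ) / M :=
        Finset.sum_le_sum hterm
    _ = n / M * (ε * M ^ (i : ℕ)) := by
        rw [Finset.sum_const, Finset.card_univ, Fintype.card_fin, nsmul_eq_mul]
        ring
    _ ≤ L i * (ε * M ^ (i : ℕ)) :=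
        mul_le_mul_of_nonneg_right (hqM.trans (hqL i)) (by positivity)

theorem Network.p_le_one {n l : ℕ} (N : Network n l) (i j : Fin n) : N.p i j ≤ 1 := by
  have hle := Finset.single_le_sum (fun k _ => N.hp_nonneg i k) (Finset.mem_univ j)
  linarith [N.hpQ i, N.hQ_nonneg i]

/-- The supply never exceeds the free space, also for a full cell (by continuity). -/
theorem Network.supply_le {n l : ℕ} (N : Network n l) {d : Fin l → ℝ} (hd : d ∈ N.D)
    {x : Fin n → ℝ} (hx : x ∈ stateSet N.a) (i : Fin n) : N.g i d x ≤ N.a i - x i := by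
  rcases (hx i).2.lt_or_eq with hlt | hfull
  · exact (N.hg_pos i d hd x hx hlt).2
  set γ : ℝ → (Fin l → ℝ) × (Fin n → ℝ) := fun θ => (d, θ • x) with hγ
  have hmem : Set.MapsTo γ (Set.Icc 0 1) (N.D ×ˢ stateSet N.a) := by
    refine fun θ hθ => ⟨hd, fun j => ⟨mul_nonneg hθ.1 (hx j).1, ?_⟩⟩
    exact (mul_le_of_le_one_left (hx j).1 hθ.2).trans (hx j).2
  have hcont : ContinuousOn (fun θ : ℝ => N.g i d (θ • x)) (Set.Icc 0 1) :=
    (N.hg_cont i).comp (by fun_prop : Continuous γ).continuousOn hmem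
  have hlim : Filter.Tendsto (fun θ : ℝ => N.g i d (θ • x)) (nhdsWithin 1 (Set.Ico 0 1))
      (nhds (N.g i d x)) := by
    have h := (hcont 1 (by simp)).mono Set.Ico_subset_Icc_self
    simpa [ContinuousWithinAt] using h
  have hlim' : Filter.Tendsto (fun θ : ℝ => N.a i - θ * x i) (nhdsWithin 1 (Set.Ico 0 1))
      (nhds (N.a i - x i)) := by
    have h : ContinuousAt (fun θ : ℝ => N.a i - θ * x i) 1 := by fun_prop
    simpa using h.tendsto.mono_left nhdsWithin_le_nhds
  have : (nhdsWithin (1 : ℝ) (Set.Ico 0 1)).NeBot := by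
    rw [nhdsWithin_Ico_eq_nhdsLT zero_lt_one]
    infer_instance
  refine le_of_tendsto_of_tendsto hlim hlim' ?_
  filter_upwards [self_mem_nhdsWithin] with θ hθ
  refine (N.hg_pos i d hd _ (hmem (Set.Ico_subset_Icc_self hθ)).2 ?_).2
  have ha := N.ha i
  change θ * x i < N.a i
  rw [hfull]
  exact mul_lt_of_lt_one_left ha hθ.2

theorem Network.update_mem_stateSet {n l : ℕ} (N : Network n l) {d : Fin l → ℝ}
    (hd : d ∈ N.D) {x v : Fin n → ℝ} (hx : x ∈ stateSet N.a) (hv : ∀ i, 0 ≤ v i) :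
    N.update d x v ∈ stateSet N.a := by
  intro i
  have hf := N.hf_nonneg i d hd _ (hx i)
  have hs := N.hs01 i d hd x hx v hv
  have hsf0 : 0 ≤ N.s i d x v * N.f i d (x i) := mul_nonneg hs.1 hf
  have hsf : N.s i d x v * N.f i d (x i) ≤ x i :=
    (mul_le_of_le_one_left hf hs.2).trans (N.hf_le i d hd _ (hx i))
  have hwv : 0 ≤ N.w i d x v * v i := mul_nonneg (N.hw01 i d hd x hx v hv).1 (hv i)
  have hsum : 0 ≤ ∑ j, N.p j i * (N.s j d x v * N.f j d (x j)) :=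
    Finset.sum_nonneg fun j _ => mul_nonneg (N.hp_nonneg j i)
      (mul_nonneg (N.hs01 j d hd x hx v hv).1 (N.hf_nonneg j d hd _ (hx j)))
  have hin := N.h27 i d hd x hx v hv
  have hg := N.supply_le hd hx i
  constructor <;> unfold Network.update <;> linarith

theorem feedback_mem_Icc {n : ℕ} {vstar b : Fin n → ℝ} (hb : ∀ i, b i ≤ vstar i)
    {K : Matrix (Fin n) (Fin n) ℝ} (hK : ∀ i j, 0 ≤ K i j) {τ : ℝ} (hτ : 0 < τ)
    (xstar x : Fin n → ℝ) (i : Fin n) :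
    feedback vstar b K τ xstar x i ∈ Set.Icc (b i) (vstar i) := by
  have hsum : 0 ≤ τ⁻¹ * ∑ j, K i j * max 0 (x j - xstar j) :=
    mul_nonneg (inv_pos.2 hτ).le
      (Finset.sum_nonneg fun j _ => mul_nonneg (hK i j) (le_max_left _ _))
  have h0 := le_max_left 0 (1 - τ⁻¹ * ∑ j, K i j * max 0 (x j - xstar j))
  have h1 : max 0 (1 - τ⁻¹ * ∑ j, K i j * max 0 (x j - xstar j)) ≤ 1 :=
    max_le zero_le_one (by linarith)
  unfold feedback
  constructor <;> nlinarith [hb i]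

theorem feedback_eq_of_saturated {n : ℕ} (vstar b : Fin n → ℝ)
    {K : Matrix (Fin n) (Fin n) ℝ} (hK : ∀ i j, 0 ≤ K i j) {τ : ℝ}
    (hτ : τ ∈ Set.Ioo (0 : ℝ) 1) {xstar x : Fin n → ℝ} {i j : Fin n}
    (hj : 1 ≤ K i j * (x j - xstar j)) :
    feedback vstar b K τ xstar x i = b i := by
  have hsum : 1 ≤ ∑ k, K i k * max 0 (x k - xstar k) :=
    (hj.trans (mul_le_mul_of_nonneg_left (le_max_right _ _) (hK i j))).trans
      (Finset.single_le_sum (f := fun k => K i k * max 0 (x k - xstar k))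
        (fun k _ => mul_nonneg (hK i k) (le_max_left _ _)) (Finset.mem_univ j))
  have hτ' : 1 ≤ τ⁻¹ := (one_le_inv₀ hτ.1).2 hτ.2.le
  have : 1 ≤ τ⁻¹ * ∑ k, K i k * max 0 (x k - xstar k) := one_le_mul_of_one_le_of_one_le hτ' hsum
  unfold feedback
  rw [max_eq_left (by linarith)]
  ring

/-- A box inside the uncongested region is positively invariant for inflows `v ≤ v*` when the
demand at its upper corner dominates the total inflow there. -/
theorem Network.update_le_of_le {n l : ℕ} (N : Network n l) (h1 : H1 N) (h3 : H3 N)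
    (h4 : H4 N h1.δt h3.vmax) {vstar β : Fin n → ℝ} (hvstar : ∀ i, vstar i ≤ h3.vmax i)
    (hβ : ∀ i, β i ∈ Set.Icc 0 (h4.μ i)) {d : Fin l → ℝ} (hd : d ∈ N.D)
    (hbal : ∀ i, vstar i + ∑ j, N.p j i * N.f j d (β j) ≤ N.f i d (β i))
    {x v : Fin n → ℝ} (hx : x ∈ stateSet N.a) (hxβ : ∀ i, x i ≤ β i)
    (hv : ∀ i, 0 ≤ v i) (hvv : ∀ i, v i ≤ vstar i) (i : Fin n) :
    N.update d x v i ≤ β i := by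
  have hδ : ∀ j, h4.μ j ≤ h1.δ j := fun j => (h4.hμ j).2.le.trans (h1.hδt j).2
  have hβδ : ∀ j, β j ∈ Set.Icc 0 (h1.δ j) := fun j => ⟨(hβ j).1, (hβ j).2.trans (hδ j)⟩
  have hxδ : ∀ j, x j ∈ Set.Icc 0 (h1.δ j) := fun j => ⟨(hx j).1, (hxβ j).trans (hβδ j).2⟩
  have huncong := N.h28 d hd x hx v hv fun j =>
    (add_le_add_left ((hvv j).trans (hvstar j)) _).trans
      (h4.hsupply j d hd x hx fun k => (hxβ k).trans (hβ k).2)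
  have hinflow : ∑ j, N.p j i * N.f j d (x j) ≤ ∑ j, N.p j i * N.f j d (β j) :=
    Finset.sum_le_sum fun j _ => mul_le_mul_of_nonneg_left
      ((h1.hf_mono j d hd).monotoneOn (hxδ j) (hβδ j) (hxβ j)) (N.hp_nonneg j i)
  have hlip : N.f i d (β i) - N.f i d (x i) ≤ β i - x i := by
    have hsub : 0 ≤ β i - x i := sub_nonneg.2 (hxβ i)
    have h := h1.hlip_up i d hd _ (hxδ i) _ (hβδ i)
    rw [abs_of_nonneg hsub] at h
    exact (le_abs_self _).trans (h.trans (mul_le_of_le_one_left hsub (h1.hG i).2))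
  have hupd : N.update d x v i
      = x i + v i - N.f i d (x i) + ∑ j, N.p j i * N.f j d (x j) := by
    simp [Network.update, huncong]
  linarith [hbal i, hvv i]

/-- Arbitrarily close above an equilibrium there is an upper corner at which the demand dominates
the total inflow, uniformly in the disturbance. -/
theorem Network.exists_dominating_corner {n l : ℕ} (N : Network n l) (h1 : H1 N) (h2 : N.H2)
    {xstar vstar μ : Fin n → ℝ} (hμ : ∀ i, μ i ≤ h1.δt i)
    (hxstar : ∀ i, xstar i ∈ Set.Ioo 0 (μ i))
    (heq : ∀ d ∈ N.D, ∀ i,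
      N.f i d (xstar i) = vstar i + ∑ j, N.p j i * N.f j d (xstar j)) :
    ∃ β : Fin n → ℝ, (∀ i, β i ∈ Set.Ioc (xstar i) (μ i)) ∧
      ∀ d ∈ N.D, ∀ i, vstar i + ∑ j, N.p j i * N.f j d (β j) ≤ N.f i d (β i) := by
  obtain ⟨e, he, hsub⟩ := exists_pos_subinvariant N.p N.p_le_one h2 h1.L
    (fun i => μ i - xstar i) (fun i => (h1.hL i).1) fun i => sub_pos.2 (hxstar i).2
  have hle : ∀ i, xstar i + e i ≤ μ i := fun i => by linarith [(he i).2]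
  refine ⟨fun i => xstar i + e i, fun i => ⟨by linarith [(he i).1], hle i⟩,
    fun d hd i => ?_⟩
  have hxt : ∀ j, xstar j ∈ Set.Icc 0 (h1.δt j) := fun j =>
    ⟨(hxstar j).1.le, (hxstar j).2.le.trans (hμ j)⟩
  have hβt : ∀ j, xstar j + e j ∈ Set.Icc 0 (h1.δt j) := fun j =>
    ⟨add_nonneg (hxstar j).1.le (he j).1.le, (hle j).trans (hμ j)⟩
  have hIcc : ∀ j, Set.Icc 0 (h1.δt j) ⊆ Set.Icc 0 (h1.δ j) := fun j =>
    Set.Icc_subset_Icc_right (h1.hδt j).2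
  have hup : ∀ j, N.f j d (xstar j + e j) ≤ N.f j d (xstar j) + e j := by
    intro j
    have h := h1.hlip_up j d hd _ (hIcc j (hxt j)) _ (hIcc j (hβt j))
    rw [add_sub_cancel_left, abs_of_pos (he j).1] at h
    linarith [le_abs_self (N.f j d (xstar j + e j) - N.f j d (xstar j)),
      mul_le_of_le_one_left (he j).1.le (h1.hG j).2]
  have hlow : N.f i d (xstar i) + h1.L i * e i ≤ N.f i d (xstar i + e i) := by
    have hmono := (h1.hf_mono i d hd).monotoneOn (hIcc i (hxt i)) (hIcc i (hβt i))
      (le_add_of_nonneg_right (he i).1.le)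
    have h := h1.hlip_low i d hd _ (hxt i) _ (hβt i)
    rw [add_sub_cancel_left, abs_of_pos (he i).1, abs_of_nonneg (sub_nonneg.2 hmono)] at h
    linarith
  have hinflow : ∑ j, N.p j i * N.f j d (xstar j + e j)
      ≤ ∑ j, N.p j i * N.f j d (xstar j) + ∑ j, N.p j i * e j := by
    rw [← Finset.sum_add_distrib]
    refine Finset.sum_le_sum fun j _ => ?_
    rw [← mul_add]
    exact mul_le_mul_of_nonneg_left (hup j) (N.hp_nonneg j i)
  linarith [hsub i, heq d hd i]

/-- **Lemma 3.6.** Under (H1), (H2), (H3), (H4), assume the existence of an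
uncongested equilibrium point `x*` with `x* i ∈ (0, μ i)` and
`v* i ∈ [0, min(vmax i, min{g i (d,0) : d ∈ D}))` satisfying (3.1). Let `r i > 0`
with `r i > ∑ j, r j * p i j` and let `C > 0` satisfy the contraction estimate
(2.14) for all `v` with `0 ≤ v ≤ v*`. Assume there exists `b ∈ ℝ₊ⁿ` with `b ≤ v*`
such that `r'b ≤ C min_i (r i * x* i)`. Then there exist constants
`β i ∈ (x* i, μ i]` and a non-negative matrix `K` such that for every `τ ∈ (0,1)`
the set `Ω = [0,β₁] × ⋯ × [0,βₙ]` is a trapping region for the closed-loop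
system (2.9) with (3.3): there is `m : ℕ` such that every solution from any
initial condition in `S`, under any disturbance sequence in `D`, lies in `Ω`
for all `t ≥ m`. -/
theorem stmt11 {n l : ℕ} (hn : 1 ≤ n) (N : Network n l)
    (h1 : H1 N) (h2 : N.H2) (h3 : H3 N) (h4 : H4 N h1.δt h3.vmax)
    (xstar vstar : Fin n → ℝ)
    (hxstar : ∀ i, xstar i ∈ Set.Ioo 0 (h4.μ i))
    (hvstar_nonneg : ∀ i, 0 ≤ vstar i)
    (hvstar : ∀ i, vstar i < min (h3.vmax i) (N.gmin i))
    (heq : ∀ d ∈ N.D, ∀ i,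
      N.f i d (xstar i) = vstar i + ∑ j, N.p j i * N.f j d (xstar j))
    (r : Fin n → ℝ) (hr : ∀ i, 0 < r i)
    (hr' : ∀ i, ∑ j, r j * N.p i j < r i)
    (C : ℝ) (hC : 0 < C)
    (hC' : ∀ d ∈ N.D, ∀ x ∈ stateSet N.a, ∀ v : Fin n → ℝ,
      (∀ i, 0 ≤ v i ∧ v i ≤ vstar i) →
      ∑ i, r i * N.update d x v i ≤
        (1 - C) * ∑ i, r i * x i + ∑ i, r i * v i)
    (b : Fin n → ℝ) (hb_nonneg : ∀ i, 0 ≤ b i) (hb : ∀ i, b i ≤ vstar i)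
    (hrb : ∀ i, ∑ j, r j * b j ≤ C * (r i * xstar i)) :
    ∃ β : Fin n → ℝ, (∀ i, β i ∈ Set.Ioc (xstar i) (h4.μ i)) ∧
      ∃ K : Matrix (Fin n) (Fin n) ℝ, (∀ i j, 0 ≤ K i j) ∧
      ∀ τ ∈ Set.Ioo (0 : ℝ) 1,
      ∃ m : ℕ, ∀ d : ℕ → Fin l → ℝ, (∀ t, d t ∈ N.D) →
        ∀ x : ℕ → Fin n → ℝ, x 0 ∈ stateSet N.a →
        IsClosedLoopSolution N vstar b K τ xstar d x →
        ∀ t ≥ m, ∀ i, x t i ∈ Set.Icc 0 (β i) := by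
  obtain ⟨β, hβ, hbal⟩ := N.exists_dominating_corner h1 h2 (fun i => (h4.hμ i).2.le) hxstar heq
  obtain ⟨ε, hε, hεβ⟩ := exists_pos_forall_le (fun i => β i - xstar i)
    fun i => sub_pos.2 (hβ i).1
  obtain ⟨ρ, hρ, hρβ⟩ := exists_pos_forall_le (fun i => C * (r i * (β i - xstar i)))
    fun i => mul_pos hC (mul_pos (hr i) (sub_pos.2 (hβ i).1))
  have hK : ∀ i j, 0 ≤ (fun _ _ => ε⁻¹ : Matrix (Fin n) (Fin n) ℝ) i j :=
    fun _ _ => (inv_pos.2 hε).le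
  refine ⟨β, hβ, fun _ _ => ε⁻¹, hK, fun τ hτ => ?_⟩
  obtain ⟨m, hm⟩ := exists_nat_gt ((∑ i, r i * N.a i) / ρ)
  rw [div_lt_iff₀ hρ] at hm
  refine ⟨m, fun d hd x hx0 hsol => ?_⟩
  have hfb := fun t => feedback_mem_Icc hb hK hτ.1 xstar (x t)
  have hfb0 := fun t i => (hb_nonneg i).trans (hfb t i).1
  have hS : ∀ t, x t ∈ stateSet N.a := by
    intro t
    induction t with
    | zero => exact hx0
    | succ t ih =>
      rw [hsol t]
      exact N.update_mem_stateSet (hd t) ih (hfb0 t)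
  have hdecr : ∀ t, ¬ (∀ i, x t i ≤ β i) →
      ∑ i, r i * x (t + 1) i ≤ ∑ i, r i * x t i - ρ := by
    intro t ht
    push Not at ht
    obtain ⟨j, hj⟩ := ht
    have hfeq : feedback vstar b (fun _ _ => ε⁻¹) τ xstar (x t) = b := by
      funext i
      refine feedback_eq_of_saturated vstar b hK hτ (j := j) ?_
      rw [inv_mul_eq_div, one_le_div hε]
      linarith [hεβ j]
    have hstep := hC' (d t) (hd t) (x t) (hS t) b fun i => ⟨hb_nonneg i, hb i⟩
    have hsingle : r j * x t j ≤ ∑ i, r i * x t i :=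
      Finset.single_le_sum (f := fun i => r i * x t i)
        (fun i _ => mul_nonneg (hr i).le (hS t i).1) (Finset.mem_univ j)
    have hbound : C * (r j * β j) ≤ C * ∑ i, r i * x t i :=
      mul_le_mul_of_nonneg_left
        ((mul_le_mul_of_nonneg_left hj.le (hr j).le).trans hsingle) hC.le
    have hρj := hρβ j
    rw [hsol t, hfeq]
    linarith [hrb j]
  have hdich : ∀ t : ℕ, (∀ i, x t i ≤ β i) ∨
      ∑ i, r i * x t i ≤ ∑ i, r i * N.a i - ρ * t := by
    intro t
    induction t with
    | zero =>
      right
      simpa using Finset.sum_le_sum fun i (_ : i ∈ Finset.univ) =>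
        mul_le_mul_of_nonneg_left (hx0 i).2 (hr i).le
    | succ t ih =>
      by_cases ht : ∀ i, x t i ≤ β i
      · left
        rw [hsol t]
        exact N.update_le_of_le h1 h3 h4
          (fun i => ((hvstar i).trans_le (min_le_left _ _)).le)
          (fun i => ⟨(hxstar i).1.le.trans (hβ i).1.le, (hβ i).2⟩) (hd t)
          (hbal (d t) (hd t)) (hS t) ht (hfb0 t) fun i => (hfb t i).2
      · right
        have hV := ih.resolve_left ht
        have hV' := hdecr t ht
        push_cast
        linarith
  intro t ht i
  refine ⟨(hS t i).1, ?_⟩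
  rcases hdich t with h | h
  · exact h i
  · have hV : 0 ≤ ∑ i, r i * x t i :=
      Finset.sum_nonneg fun i _ => mul_nonneg (hr i).le (hS t i).1
    have hmt : (m : ℝ) * ρ ≤ t * ρ := mul_le_mul_of_nonneg_right (by exact_mod_cast ht) hρ.le
    linarith
end
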